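/- Let G be a connected graph with positive edge lengths ℓ, let H be a subgraph of G, let U be a vertex set with ∂H ⊆ U ⊆ V(H), let 0 < δ ≤ ε(G,ℓ), and let d̂_G be the corresponding perturbed distance. Then H is a convex subgraph of G if and only if Σ_{x,y∈U} d_H(x,y) = Σ_{x,y∈U} d̂_G(x,y), where the sums range over all ordered pairs of vertices of U. -/

import Mathlib

open scoped ENNReal

namespace PaperIso

variable {V : Type*}

/-- The length of a walk: sum of the lengths of its edges (with multiplicity). -/
noncomputable def wLen {G : SimpleGraph V} (ℓ : Sym2 V → ℝ≥0∞) {x y : V} (w : G.Walk x y) :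
    ℝ≥0∞ :=
  (w.edges.map ℓ).sum

/-- The weighted distance in `G`: the infimum of the lengths of walks from `x` to `y`;
it equals `⊤` when there is no walk from `x` to `y`. -/
noncomputable def eDist (G : SimpleGraph V) (ℓ : Sym2 V → ℝ≥0∞) (x y : V) : ℝ≥0∞ :=
  ⨅ w : G.Walk x y, wLen ℓ w

/-- The edge lengths are positive reals (positive and finite) on every edge of `G`. -/
def PosLengths (G : SimpleGraph V) (ℓ : Sym2 V → ℝ≥0∞) : Prop :=
  ∀ e ∈ G.edgeSet, 0 < ℓ e ∧ ℓ e < ⊤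

/-- The boundary `∂H`: vertices of `H` incident to some edge of `E(G) \ E(H)`. -/
def boundary (G : SimpleGraph V) (H : G.Subgraph) : Set V :=
  {v | v ∈ H.verts ∧ ∃ u, G.Adj v u ∧ ¬ H.Adj v u}

/-- `H` is an isometric subgraph of `G` (with respect to lengths `ℓ`). -/
def IsIsometric (G : SimpleGraph V) (ℓ : Sym2 V → ℝ≥0∞) (H : G.Subgraph) : Prop :=
  ∀ x ∈ H.verts, ∀ y ∈ H.verts, eDist H.spanningCoe ℓ x y = eDist G ℓ x y

/-- `p` is a minimum-length (shortest) path with respect to lengths `ℓ`. -/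
def IsShortestPath (G : SimpleGraph V) (ℓ : Sym2 V → ℝ≥0∞) {x y : V} (p : G.Walk x y) : Prop :=
  p.IsPath ∧ ∀ q : G.Walk x y, q.IsPath → wLen ℓ p ≤ wLen ℓ q

/-- `H` is a (geodesically) convex subgraph of `G`: every minimum-length path of `G`
between vertices of `H` is contained in `H`. -/
def IsConvex (G : SimpleGraph V) (ℓ : Sym2 V → ℝ≥0∞) (H : G.Subgraph) : Prop :=
  ∀ x ∈ H.verts, ∀ y ∈ H.verts, ∀ p : G.Walk x y, IsShortestPath G ℓ p → p.toSubgraph ≤ H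

/-- `ε(G,ℓ) = (1/n) · min{ℓ(π) − ℓ(π') : π, π' paths of G with ℓ(π) > ℓ(π')}`. -/
noncomputable def eps [Fintype V] (G : SimpleGraph V) (ℓ : Sym2 V → ℝ≥0∞) : ℝ≥0∞ :=
  (⨅ (x : V) (y : V) (x' : V) (y' : V) (p : G.Path x y) (q : G.Path x' y')
      (_ : wLen ℓ (q : G.Walk x' y') < wLen ℓ (p : G.Walk x y)),
      (wLen ℓ (p : G.Walk x y) - wLen ℓ (q : G.Walk x' y'))) / (Fintype.card V : ℝ≥0∞)

open scoped Classical in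
/-- The perturbed lengths `ℓ̂`: edges not in `H` are shortened by `δ`. -/
noncomputable def pert {G : SimpleGraph V} (H : G.Subgraph) (ℓ : Sym2 V → ℝ≥0∞) (δ : ℝ≥0∞) :
    Sym2 V → ℝ≥0∞ :=
  fun e => if e ∈ H.edgeSet then ℓ e else ℓ e - δ

theorem wLen_append {G : SimpleGraph V} (ℓ : Sym2 V → ℝ≥0∞) {x y z : V} (p : G.Walk x y)
    (q : G.Walk y z) : wLen ℓ (p.append q) = wLen ℓ p + wLen ℓ q := by
  simp [wLen]

theorem wLen_lt_top {G : SimpleGraph V} {ℓ : Sym2 V → ℝ≥0∞} (hℓ : PosLengths G ℓ) {x y : V}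
    (p : G.Walk x y) : wLen ℓ p < ⊤ := by
  induction p with
  | nil => simp [wLen]
  | cons h p ih =>
    simp only [wLen, SimpleGraph.Walk.edges_cons, List.map_cons, List.sum_cons] at ih ⊢
    exact ENNReal.add_lt_top.2 ⟨(hℓ _ h).2, ih⟩

open scoped Classical in
theorem wLen_bypass_le {G : SimpleGraph V} (ℓ : Sym2 V → ℝ≥0∞) {x y : V} (p : G.Walk x y) :
    wLen ℓ p.bypass ≤ wLen ℓ p := by
  have h : p.bypass.edges.Subperm p.edges :=
    List.subperm_of_subset p.bypass_isPath.isTrail.edges_nodup p.edges_bypass_subset_edges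
  obtain ⟨l, hl1, hl2⟩ := h
  unfold wLen
  rw [← (hl1.map ℓ).sum_eq]
  exact (hl2.map ℓ).sum_le_sum (by simp)

theorem shortest_le {G : SimpleGraph V} {ℓ : Sym2 V → ℝ≥0∞} {x y : V} {p : G.Walk x y}
    (hp : IsShortestPath G ℓ p) (q : G.Walk x y) : wLen ℓ p ≤ wLen ℓ q := by
  classical
  exact (hp.2 _ q.bypass_isPath).trans (wLen_bypass_le ℓ q)

theorem exists_shortest [Fintype V] {G : SimpleGraph V} (hG : G.Connected) (ℓ : Sym2 V → ℝ≥0∞)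
    (x y : V) : ∃ p : G.Walk x y, IsShortestPath G ℓ p := by
  classical
  obtain ⟨w⟩ := hG.preconnected x y
  have : Nonempty (G.Path x y) := ⟨w.toPath⟩
  obtain ⟨p, hp⟩ := Finite.exists_min (fun p : G.Path x y => wLen ℓ (p : G.Walk x y))
  exact ⟨p.1, p.2, fun q hq => hp ⟨q, hq⟩⟩

theorem toSubgraph_le_of_edges {G : SimpleGraph V} (H : G.Subgraph) {x y : V} (p : G.Walk x y)
    (hx : x ∈ H.verts) (h : ∀ e ∈ p.edges, e ∈ H.edgeSet) : p.toSubgraph ≤ H := by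
  induction p with
  | nil => simpa using hx
  | @cons u v w hadj p ih =>
    have h1 : H.Adj u v := h s(u, v) (by simp)
    simp only [SimpleGraph.Walk.toSubgraph, sup_le_iff]
    exact ⟨SimpleGraph.subgraphOfAdj_le_of_adj _ h1,
      ih h1.snd_mem (fun e he => h e (by simp [he]))⟩

theorem edges_of_toSubgraph_le {G : SimpleGraph V} (H : G.Subgraph) {x y : V} (p : G.Walk x y)
    (h : p.toSubgraph ≤ H) : ∀ e ∈ p.edges, e ∈ H.edgeSet := by
  intro e he
  exact SimpleGraph.Subgraph.edgeSet_mono h (by simpa using he)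

theorem split_first {G : SimpleGraph V} (H : G.Subgraph) {x y : V} (p : G.Walk x y)
    (hx : x ∈ H.verts) (h : ∃ e ∈ p.edges, e ∉ H.edgeSet) :
    ∃ a ∈ boundary G H, ∃ (q : G.Walk x a) (r : G.Walk a y), p = q.append r ∧
      ∃ e ∈ r.edges, e ∉ H.edgeSet := by
  induction p with
  | nil => simp at h
  | @cons u v w hadj p ih =>
    by_cases h1 : H.Adj u v
    · obtain ⟨a, ha, q, r, hpq, hr⟩ := ih h1.snd_mem (by
        obtain ⟨e, he, heH⟩ := h
        simp only [SimpleGraph.Walk.edges_cons, List.mem_cons] at he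
        rcases he with rfl | he
        · exact absurd h1 heH
        · exact ⟨e, he, heH⟩)
      exact ⟨a, ha, SimpleGraph.Walk.cons hadj q, r, by simp [hpq], hr⟩
    · exact ⟨u, ⟨hx, v, hadj, h1⟩, SimpleGraph.Walk.nil, SimpleGraph.Walk.cons hadj p, rfl, h⟩

theorem split_last {G : SimpleGraph V} (H : G.Subgraph) {x y : V} (p : G.Walk x y)
    (hy : y ∈ H.verts) (h : ∃ e ∈ p.edges, e ∉ H.edgeSet) :
    ∃ b ∈ boundary G H, ∃ (q : G.Walk x b) (r : G.Walk b y), p = q.append r ∧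
      ∃ e ∈ q.edges, e ∉ H.edgeSet := by
  obtain ⟨a, ha, q, r, hpq, e, he, heH⟩ := split_first H p.reverse hy (by simpa using h)
  refine ⟨a, ha, r.reverse, q.reverse, ?_, e, by simpa using he, heH⟩
  rw [← SimpleGraph.Walk.reverse_append, ← hpq, SimpleGraph.Walk.reverse_reverse]

theorem eDist_H_le {G : SimpleGraph V} (H : G.Subgraph) (ℓ : Sym2 V → ℝ≥0∞) {x y : V}
    (p : G.Walk x y) (h : ∀ e ∈ p.edges, e ∈ H.edgeSet) :
    eDist H.spanningCoe ℓ x y ≤ wLen ℓ p := by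
  refine (iInf_le _ (p.transfer H.spanningCoe (by simpa using h))).trans ?_
  simp [wLen]

theorem wLen_pert_eq {G : SimpleGraph V} (H : G.Subgraph) (ℓ : Sym2 V → ℝ≥0∞) (δ : ℝ≥0∞)
    {x y : V} (p : G.Walk x y) (h : ∀ e ∈ p.edges, e ∈ H.edgeSet) :
    wLen (pert H ℓ δ) p = wLen ℓ p := by
  unfold wLen
  congr 1
  exact List.map_congr_left (fun e he => if_pos (h e he))

theorem pert_le {G : SimpleGraph V} (H : G.Subgraph) (ℓ : Sym2 V → ℝ≥0∞) (δ : ℝ≥0∞) (e : Sym2 V) :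
    pert H ℓ δ e ≤ ℓ e := by
  unfold pert
  split_ifs
  · exact le_rfl
  · exact tsub_le_self

theorem wLen_pert_le {G : SimpleGraph V} (H : G.Subgraph) (ℓ : Sym2 V → ℝ≥0∞) (δ : ℝ≥0∞)
    {x y : V} (p : G.Walk x y) : wLen (pert H ℓ δ) p ≤ wLen ℓ p :=
  List.sum_le_sum (fun e _ => pert_le H ℓ δ e)

theorem wLen_pert_lt {G : SimpleGraph V} {ℓ : Sym2 V → ℝ≥0∞} (hℓ : PosLengths G ℓ)
    (H : G.Subgraph) {δ : ℝ≥0∞} (hδ : 0 < δ)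
    {x y : V} (p : G.Walk x y) (h : ∃ e ∈ p.edges, e ∉ H.edgeSet) :
    wLen (pert H ℓ δ) p < wLen ℓ p := by
  induction p with
  | nil => simp at h
  | @cons u v w hadj p ih =>
    have e1 : ∀ f : Sym2 V → ℝ≥0∞, wLen f (SimpleGraph.Walk.cons hadj p) = f s(u, v) + wLen f p :=
      fun f => by simp [wLen]
    rw [e1, e1]
    by_cases h2 : ∃ e ∈ p.edges, e ∉ H.edgeSet
    · exact ENNReal.add_lt_add_of_le_of_lt
        ((pert_le H ℓ δ _).trans_lt (hℓ _ hadj).2).ne (pert_le H ℓ δ _) (ih h2)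
    · have h1 : s(u, v) ∉ H.edgeSet := by
        obtain ⟨e, he, heH⟩ := h
        simp only [SimpleGraph.Walk.edges_cons, List.mem_cons] at he
        rcases he with rfl | he
        · exact heH
        · exact absurd ⟨e, he, heH⟩ h2
      refine ENNReal.add_lt_add_of_lt_of_le
        ((wLen_pert_le H ℓ δ p).trans_lt (wLen_lt_top hℓ p)).ne ?_ (wLen_pert_le H ℓ δ p)
      unfold pert
      rw [if_neg h1]
      exact ENNReal.sub_lt_self (hℓ _ hadj).2.ne (hℓ _ hadj).1.ne' hδ.ne'

theorem wLen_le_pert_add {G : SimpleGraph V} (ℓ : Sym2 V → ℝ≥0∞)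
    (H : G.Subgraph) (δ : ℝ≥0∞) {x y : V} (p : G.Walk x y) :
    wLen ℓ p ≤ wLen (pert H ℓ δ) p + p.length * δ := by
  induction p with
  | nil => simp [wLen]
  | @cons u v w hadj p ih =>
    have e1 : ∀ f : Sym2 V → ℝ≥0∞, wLen f (SimpleGraph.Walk.cons hadj p) = f s(u, v) + wLen f p :=
      fun f => by simp [wLen]
    rw [e1, e1]
    have h1 : ℓ s(u, v) ≤ pert H ℓ δ s(u, v) + δ := by
      unfold pert
      split_ifs
      · exact le_self_add
      · exact le_tsub_add
    refine (add_le_add h1 ih).trans (le_of_eq ?_)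
    simp only [SimpleGraph.Walk.length_cons]
    push_cast
    ring

theorem eDist_pert_le {G : SimpleGraph V} (H : G.Subgraph) (ℓ : Sym2 V → ℝ≥0∞) (δ : ℝ≥0∞)
    (x y : V) : eDist G (pert H ℓ δ) x y ≤ eDist H.spanningCoe ℓ x y := by
  refine le_iInf fun w => ?_
  refine (iInf_le _ (w.mapLe H.spanningCoe_le)).trans (le_of_eq ?_)
  have hE : ∀ e ∈ (w.mapLe H.spanningCoe_le).edges, e ∈ H.edgeSet := by
    intro e he
    rw [SimpleGraph.Walk.edges_mapLe_eq_edges] at he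
    simpa using w.edges_subset_edgeSet he
  rw [wLen_pert_eq H ℓ δ _ hE]
  simp [wLen]

theorem card_mul_le [Fintype V] {G : SimpleGraph V} {ℓ : Sym2 V → ℝ≥0∞} {δ : ℝ≥0∞}
    (hδ : δ ≤ eps G ℓ) {x y : V} (p q : G.Walk x y) (hp : p.IsPath) (hq : q.IsPath)
    (h : wLen ℓ q < wLen ℓ p) : (Fintype.card V : ℝ≥0∞) * δ ≤ wLen ℓ p - wLen ℓ q := by
  have hc : (Fintype.card V : ℝ≥0∞) ≠ 0 := by
    have : Nonempty V := ⟨x⟩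
    exact_mod_cast Fintype.card_ne_zero
  unfold eps at hδ
  rw [ENNReal.le_div_iff_mul_le (Or.inl hc) (Or.inl (by simp))] at hδ
  rw [mul_comm]
  refine hδ.trans ?_
  exact iInf_le_of_le x <| iInf_le_of_le y <| iInf_le_of_le x <| iInf_le_of_le y <|
    iInf_le_of_le ⟨p, hp⟩ <| iInf_le_of_le ⟨q, hq⟩ <| iInf_le_of_le h le_rfl

theorem eDist_eq_of_convex [Fintype V] {G : SimpleGraph V} {ℓ : Sym2 V → ℝ≥0∞}
    (hG : G.Connected) (hℓ : PosLengths G ℓ) (H : G.Subgraph)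
    {δ : ℝ≥0∞} (hδ : δ ≤ eps G ℓ) (hc : IsConvex G ℓ H) {x y : V} (hx : x ∈ H.verts)
    (hy : y ∈ H.verts) : eDist H.spanningCoe ℓ x y = eDist G (pert H ℓ δ) x y := by
  classical
  refine le_antisymm (le_iInf fun w => ?_) (eDist_pert_le H ℓ δ x y)
  refine le_trans ?_ (wLen_bypass_le (pert H ℓ δ) w)
  have hp : w.bypass.IsPath := w.bypass_isPath
  generalize w.bypass = p at hp
  obtain ⟨s, hs⟩ := exists_shortest hG ℓ x y
  by_cases hps : wLen ℓ p ≤ wLen ℓ s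
  · have hpe := edges_of_toSubgraph_le H p
      (hc x hx y hy p ⟨hp, fun q hq => hps.trans (hs.2 q hq)⟩)
    rw [wLen_pert_eq H ℓ δ p hpe]
    exact eDist_H_le H ℓ p hpe
  · push Not at hps
    refine (eDist_H_le H ℓ s (edges_of_toSubgraph_le H s (hc x hx y hy s hs))).trans ?_
    have h1 := card_mul_le hδ p s hp hs.1 hps
    have h2 : (p.length : ℝ≥0∞) * δ ≤ Fintype.card V * δ := by
      gcongr
      exact hp.length_lt.le
    have h3 := wLen_le_pert_add ℓ H δ p
    have h4 : (Fintype.card V : ℝ≥0∞) * δ ≠ ⊤ :=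
      (h1.trans_lt (tsub_le_self.trans_lt (wLen_lt_top hℓ p))).ne
    have h5 : wLen ℓ s + Fintype.card V * δ ≤ wLen ℓ p := by
      calc wLen ℓ s + Fintype.card V * δ ≤ wLen ℓ s + (wLen ℓ p - wLen ℓ s) := by gcongr
        _ = wLen ℓ p := add_tsub_cancel_of_le hps.le
    have h6 : wLen ℓ s + Fintype.card V * δ ≤ wLen (pert H ℓ δ) p + Fintype.card V * δ :=
      h5.trans (h3.trans (by gcongr))
    exact (ENNReal.add_le_add_iff_right h4).1 h6

theorem convex_of_eDist_eq {G : SimpleGraph V} {ℓ : Sym2 V → ℝ≥0∞}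
    (hℓ : PosLengths G ℓ) (H : G.Subgraph) {δ : ℝ≥0∞} (hδ : 0 < δ)
    (h : ∀ a ∈ boundary G H, ∀ b ∈ boundary G H,
      eDist H.spanningCoe ℓ a b ≤ eDist G (pert H ℓ δ) a b) : IsConvex G ℓ H := by
  intro x hx y hy p hp
  by_contra hcon
  have hbad : ∃ e ∈ p.edges, e ∉ H.edgeSet := by
    by_contra hno
    push Not at hno
    exact hcon (toSubgraph_le_of_edges H p hx hno)
  obtain ⟨a, ha, q, r, rfl, hr⟩ := split_first H p hx hbad
  obtain ⟨b, hb, r1, r2, rfl, hr1⟩ := split_last H r hy hr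
  have h1 : eDist H.spanningCoe ℓ a b < wLen ℓ r1 :=
    ((h a ha b hb).trans (iInf_le _ r1)).trans_lt (wLen_pert_lt hℓ H hδ r1 hr1)
  obtain ⟨w, hw⟩ := iInf_lt_iff.1 h1
  have hw' : wLen ℓ (w.mapLe H.spanningCoe_le) < wLen ℓ r1 := by
    simpa [wLen] using hw
  have h2 := shortest_le hp (q.append ((w.mapLe H.spanningCoe_le).append r2))
  simp only [wLen_append] at h2
  refine absurd h2 (not_le.2 ?_)
  exact ENNReal.add_lt_add_left (wLen_lt_top hℓ q).ne
    (ENNReal.add_lt_add_right (wLen_lt_top hℓ r2).ne hw')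

theorem convex_iff_pert_sum_boundary [Fintype V] (G : SimpleGraph V) (ℓ : Sym2 V → ℝ≥0∞)
    (hG : G.Connected) (hℓ : PosLengths G ℓ) (H : G.Subgraph) (U : Set V)
    (hU1 : boundary G H ⊆ U) (hU2 : U ⊆ H.verts)
    (δ : ℝ≥0∞) (hδ0 : 0 < δ) (hδ : δ ≤ eps G ℓ) :
    IsConvex G ℓ H ↔
      ∑' (x : U) (y : U), eDist H.spanningCoe ℓ x.1 y.1
        = ∑' (x : U) (y : U), eDist G (pert H ℓ δ) x.1 y.1 := by
  classical
  constructor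
  · intro hc
    exact tsum_congr fun x => tsum_congr fun y =>
      eDist_eq_of_convex hG hℓ H hδ hc (hU2 x.2) (hU2 y.2)
  · intro hsum
    refine convex_of_eDist_eq hℓ H hδ0 fun a ha b hb => ?_
    have hfin : ∀ x y : V, eDist G (pert H ℓ δ) x y ≠ ⊤ := by
      intro x y
      obtain ⟨w⟩ := hG.preconnected x y
      exact ((iInf_le _ w).trans_lt
        ((wLen_pert_le H ℓ δ w).trans_lt (wLen_lt_top hℓ w))).ne
    by_contra hlt
    push Not at hlt
    have hin : ∀ x : U, ∑' y : U, eDist G (pert H ℓ δ) x.1 y.1 ≠ ⊤ := by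
      intro x
      rw [tsum_fintype]
      exact ENNReal.sum_ne_top.2 fun y _ => hfin _ _
    have hout : ∑' (x : U) (y : U), eDist G (pert H ℓ δ) x.1 y.1 ≠ ⊤ := by
      rw [tsum_fintype]
      exact ENNReal.sum_ne_top.2 fun x _ => hin x
    refine absurd hsum (ne_of_gt ?_)
    exact ENNReal.tsum_lt_tsum (i := (⟨a, hU1 ha⟩ : U)) hout
      (fun x => ENNReal.tsum_le_tsum fun y => eDist_pert_le H ℓ δ _ _)
      (ENNReal.tsum_lt_tsum (i := (⟨b, hU1 hb⟩ : U)) (hin _)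
        (fun y => eDist_pert_le H ℓ δ _ _) hlt)

end PaperIso
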